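/- arXiv:1405.2566 — 2 statements merged into one kernel-verified Lean document; each statement's English description precedes it below -/
import Mathlib

section
/- Let A : {1,…,N} → {1,…,K} assign each node to a module, let Pa_k ⊆ {1,…,N} be the (finite) set of parents of module k, let w_1,…,w_K ∈ ℝ, and let W ∈ ℝ^{N×N} be the structured matrix defined by W_{n r} = w_{A(n)} if r ∈ Pa_{A(n)} and W_{n r} = 0 otherwise. Suppose i ≠ j are two nodes with A(i) = A(j) = k such that neither i nor j is a parent of any module (i.e. i ∉ Pa_{k'} and j ∉ Pa_{k'} for every module k'). Then the (i,j) entry of the matrix (I−W)(I−W)ᵀ equals |Pa_k| · w_k², where |Pa_k| is the number of parents of module k. -/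
open Matrix

/-- The structured regression matrix of the module-network model:
`W n r = w (A n)` if `r` is a parent of the module of `n`, and `0` otherwise. -/
def structMatrix {N K : ℕ} (A : Fin N → Fin K) (Pa : Fin K → Finset (Fin N))
    (w : Fin K → ℝ) : Matrix (Fin N) (Fin N) ℝ :=
  fun n r => if r ∈ Pa (A n) then w (A n) else 0

/-- For two distinct nodes `i ≠ j` of the same module `k` that are not parents of any
module, the `(i,j)` entry of `(I−W)(I−W)ᵀ` equals `|Pa k| · w k²`. -/
theorem entry_of_inverse_covariance {N K : ℕ} (A : Fin N → Fin K)
    (Pa : Fin K → Finset (Fin N)) (w : Fin K → ℝ) (k : Fin K) (i j : Fin N)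
    (hij : i ≠ j) (hi : A i = k) (hj : A j = k)
    (hiP : ∀ k' : Fin K, i ∉ Pa k') (hjP : ∀ k' : Fin K, j ∉ Pa k') :
    (((1 - structMatrix A Pa w) * (1 - structMatrix A Pa w)ᵀ : Matrix (Fin N) (Fin N) ℝ) i j) =
      (Pa k).card * (w k) ^ 2 := by
  have key : ∀ r : Fin N, (1 - structMatrix A Pa w) i r * (1 - structMatrix A Pa w) j r
      = if r ∈ Pa k then (w k) ^ 2 else 0 := by
    intro r
    simp only [Matrix.sub_apply, Matrix.one_apply, structMatrix, hi, hj]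
    by_cases hr : r ∈ Pa k
    · have h1 : i ≠ r := fun h => hiP k (h ▸ hr)
      have h2 : j ≠ r := fun h => hjP k (h ▸ hr)
      simp [hr, h1, h2]
      ring
    · by_cases h1 : i = r
      · have h2 : j ≠ r := fun h => hij (h1.trans h.symm)
        simp [hr, h2]
      · simp [hr, h1]
  rw [Matrix.mul_apply]
  simp only [Matrix.transpose_apply, key]
  simp
end

section
/- Let A : {1,…,N} → {1,…,K} assign each node to a module, let Pa_k ⊆ {1,…,N} be the (finite) set of parents of module k, and assume each Pa_k is nonempty and each module contains at least two distinct nodes that are not parents of any module. Let w_1,…,w_K ∈ ℝ and w'_1,…,w'_K ∈ ℝ, and let W and W' be the structured matrices defined by W_{n r} = w_{A(n)} if r ∈ Pa_{A(n)} and 0 otherwise (respectively with w' in place of w). If (I−W)(I−W)ᵀ = (I−W')(I−W')ᵀ, then w_k² = (w'_k)² for every module k = 1,…,K. -/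
open Matrix

/-- If every module has a nonempty parent set and contains at least two distinct nodes
that are parents of no module, then equality of the inverse covariances
`(I−W)(I−W)ᵀ = (I−W')(I−W')ᵀ` forces `w k ² = w' k ²` for every module `k`. -/
theorem squared_weights_identifiable {N K : ℕ} (A : Fin N → Fin K)
    (Pa : Fin K → Finset (Fin N))
    (hPa : ∀ k : Fin K, (Pa k).Nonempty)
    (hmod : ∀ k : Fin K, ∃ i j : Fin N, i ≠ j ∧ A i = k ∧ A j = k ∧
      (∀ k' : Fin K, i ∉ Pa k') ∧ (∀ k' : Fin K, j ∉ Pa k'))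
    (w w' : Fin K → ℝ)
    (h : (1 - structMatrix A Pa w) * (1 - structMatrix A Pa w)ᵀ =
        (1 - structMatrix A Pa w') * (1 - structMatrix A Pa w')ᵀ) :
    ∀ k : Fin K, (w k) ^ 2 = (w' k) ^ 2 := by
  intro k
  obtain ⟨i, j, hij, hi, hj, hip, hjp⟩ := hmod k
  have key : ∀ v : Fin K → ℝ,
      ((1 - structMatrix A Pa v) * (1 - structMatrix A Pa v)ᵀ : Matrix (Fin N) (Fin N) ℝ) i j
        = ((Pa k).card : ℝ) * (v k) ^ 2 := by
    intro v
    have hE : (1 - structMatrix A Pa v) * (1 - structMatrix A Pa v)ᵀ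
        = 1 - structMatrix A Pa v - (structMatrix A Pa v)ᵀ
          + structMatrix A Pa v * (structMatrix A Pa v)ᵀ := by
      rw [Matrix.transpose_sub, Matrix.transpose_one]
      noncomm_ring
    rw [hE, Matrix.add_apply, Matrix.sub_apply, Matrix.sub_apply, Matrix.mul_apply]
    simp only [Matrix.transpose_apply, structMatrix, hi, hj, hip, hjp,
      Matrix.one_apply_ne hij, if_false]
    have : ∀ x : Fin N, (if x ∈ Pa k then v k else 0) * (if x ∈ Pa k then v k else 0)
        = if x ∈ Pa k then (v k) ^ 2 else 0 := by
      intro x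
      split_ifs <;> ring
    simp [this]
  have h1 := key w
  rw [h, key w'] at h1
  have hc : ((Pa k).card : ℝ) ≠ 0 := by
    exact_mod_cast (Finset.card_pos.mpr (hPa k)).ne'
  exact (mul_left_cancel₀ hc h1).symm
end
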